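/- Let A be a commutative Noetherian ring and M a nonzero finitely generated A-module with Ass(M) = {p_1, …, p_n}, the p_i pairwise distinct, and assume p_i + p_j = A for all i ≠ j. For each j set M_j = ⋂_{k ≠ j} ker(M → M_{p_k}). Let 0 = G_0 ⊆ G_1 ⊆ ⋯ ⊆ G_n = M be a coprimary filtration of M with respect to the enumeration p_1, …, p_n, so that Ass(G_i/G_{i-1}) = {p_i} for each i. Then for every i ∈ {1, …, n}, G_i = ∑_{j ≤ i} M_j. -/

import Mathlib

/-- A coprimary filtration of `M` with respect to the enumeration `p 0, …, p (n-1)` of its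
associated primes: a chain `0 = G 0 ⊆ G 1 ⊆ ⋯ ⊆ G n = M` with
`Ass(G (i+1) / G i) = {p i}` for each `i`. -/
def IsCoprimaryFiltration {A : Type*} [CommRing A] {M : Type*} [AddCommGroup M] [Module A M]
    {n : ℕ} (p : Fin n → Ideal A) (G : Fin (n + 1) → Submodule A M) : Prop :=
  G 0 = ⊥ ∧ G (Fin.last n) = ⊤ ∧ Monotone G ∧
  ∀ i : Fin n,
    associatedPrimes A
      (↥(G i.succ) ⧸ Submodule.comap (G i.succ).subtype (G i.castSucc)) = {p i}

/-- A finite module over a Noetherian ring whose only associated prime is `p` is killed by a power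
of `p`. -/
theorem exists_pow_le_annihilator_of_associatedPrimes_eq_singleton
    {A Q : Type*} [CommRing A] [IsNoetherianRing A] [AddCommGroup Q] [Module A Q]
    [Module.Finite A Q] {p : Ideal A} (h : associatedPrimes A Q = {p}) :
    ∃ m : ℕ, p ^ m ≤ Module.annihilator A Q := by
  refine Ideal.exists_pow_le_of_le_radical_of_fg ?_ (IsNoetherian.noetherian p)
  rw [← Ideal.sInf_minimalPrimes]
  refine le_sInf fun q hq => ?_
  have hq' := Module.associatedPrimes.minimalPrimes_annihilator_subset_associatedPrimes A Q hq
  rw [h, Set.mem_singleton_iff] at hq'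
  exact hq'.ge

/-- If `p` is the only associated prime of `Q`, then elements outside `p` act injectively. -/
theorem eq_zero_of_smul_eq_zero_of_associatedPrimes_eq_singleton
    {A Q : Type*} [CommRing A] [IsNoetherianRing A] [AddCommGroup Q] [Module A Q]
    {p : Ideal A} (h : associatedPrimes A Q = {p}) {s : A} (hs : s ∉ p) {x : Q}
    (hx : s • x = 0) : x = 0 := by
  by_contra hne
  have hmem : s ∈ ⋃ q ∈ associatedPrimes A Q, (q : Set A) := by
    rw [biUnion_associatedPrimes_eq_zero_divisors]
    exact ⟨x, hne, hx⟩
  rw [h] at hmem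
  exact hs (by simpa using hmem)

/-- Elements killed by a power of `p` vanish in the localization at a prime comaximal with `p`. -/
theorem torsionBySet_pow_le_ker_mkLinearMap {A M : Type*} [CommRing A] [AddCommGroup M]
    [Module A M] {p q : Ideal A} [hq : q.IsPrime] (hpq : p ⊔ q = ⊤) (m : ℕ) :
    Submodule.torsionBySet A M (p ^ m : Ideal A) ≤
      LinearMap.ker (LocalizedModule.mkLinearMap q.primeCompl M) := by
  intro x hx
  have hnot : ¬ p ^ m ≤ q := fun hle =>
    hq.ne_top (by rw [← hpq, sup_eq_right.mpr (Ideal.IsPrime.le_of_pow_le hle)])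
  obtain ⟨a, ha, haq⟩ := SetLike.not_le_iff_exists.mp hnot
  exact LocalizedModule.mem_ker_mkLinearMap_iff.mpr
    ⟨a, haq, (Submodule.mem_torsionBySet_iff _ _).mp hx ⟨a, ha⟩⟩

namespace IsCoprimaryFiltration

variable {A : Type*} [CommRing A] {M : Type*} [AddCommGroup M] [Module A M]
  {n : ℕ} {p : Fin n → Ideal A} {G : Fin (n + 1) → Submodule A M}

theorem mem_castSucc_of_smul_eq_zero [IsNoetherianRing A]
    (hG : IsCoprimaryFiltration p G) {k : Fin n} {s : A}
    (hs : s ∉ p k) {x : M} (hx : x ∈ G k.succ) (hsx : s • x = 0) : x ∈ G k.castSucc := by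
  have hzero := eq_zero_of_smul_eq_zero_of_associatedPrimes_eq_singleton (hG.2.2.2 k) hs
    (x := Submodule.Quotient.mk ⟨x, hx⟩) (by
      rw [← Submodule.Quotient.mk_smul, Submodule.Quotient.mk_eq_zero]
      simp [hsx])
  simpa using (Submodule.Quotient.mk_eq_zero _).mp hzero

theorem exists_pow_smul_le [IsNoetherianRing A] [Module.Finite A M]
    (hG : IsCoprimaryFiltration p G) (k : Fin n) :
    ∃ m : ℕ, p k ^ m • G k.succ ≤ G k.castSucc := by
  obtain ⟨m, hm⟩ :=
    exists_pow_le_annihilator_of_associatedPrimes_eq_singleton (hG.2.2.2 k)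
  refine ⟨m, Submodule.smul_le.mpr fun a ha x hx => ?_⟩
  have hzero := Module.mem_annihilator.mp (hm ha) (Submodule.Quotient.mk ⟨x, hx⟩)
  rw [← Submodule.Quotient.mk_smul, Submodule.Quotient.mk_eq_zero] at hzero
  simpa using hzero

/-- If `x` vanishes in the localization at every `p k` with `i ≤ k`, then `x ∈ G i`. -/
theorem mem_of_forall_exists_smul_eq_zero [IsNoetherianRing A]
    (hG : IsCoprimaryFiltration p G) {x : M}
    (i : Fin (n + 1)) (hx : ∀ k : Fin n, (i : ℕ) ≤ k → ∃ s ∉ p k, s • x = 0) : x ∈ G i := by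
  induction i using Fin.reverseInduction with
  | last => simp [hG.2.1]
  | cast k ih =>
    obtain ⟨s, hs, hsx⟩ := hx k le_rfl
    refine hG.mem_castSucc_of_smul_eq_zero hs (ih fun l hl => hx l ?_) hsx
    simp only [Fin.val_succ, Fin.val_castSucc] at hl ⊢
    omega

theorem prod_smul_eq_bot (hG : IsCoprimaryFiltration p G) {m : Fin n → ℕ}
    (hm : ∀ k, p k ^ m k • G k.succ ≤ G k.castSucc) (i : Fin (n + 1)) :
    (∏ j ∈ Finset.univ.filter (fun j : Fin n => (j : ℕ) < (i : ℕ)), p j ^ m j) • G i = ⊥ := by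
  induction i using Fin.induction with
  | zero => simp [hG.1]
  | succ k ih =>
    have hset : (Finset.univ.filter fun j : Fin n => (j : ℕ) < (k.succ : ℕ)) =
        insert k (Finset.univ.filter fun j : Fin n => (j : ℕ) < (k.castSucc : ℕ)) := by
      ext j
      simp only [Finset.mem_filter, Finset.mem_univ, true_and, Finset.mem_insert, Fin.ext_iff,
        Fin.val_succ, Fin.val_castSucc]
      omega
    rw [hset, Finset.prod_insert (by simp), mul_comm, Submodule.mul_smul, eq_bot_iff]
    exact (Submodule.smul_mono le_rfl (hm k)).trans ih.le

/-- For pairwise comaximal primes, each step of the filtration is generated by elements killed by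
powers of the primes that occurred so far. -/
theorem le_iSup_torsionBySet (hG : IsCoprimaryFiltration p G) {m : Fin n → ℕ}
    (hm : ∀ k, p k ^ m k • G k.succ ≤ G k.castSucc)
    (hcomax : ∀ i j, i ≠ j → p i ⊔ p j = ⊤) (i : Fin (n + 1)) :
    G i ≤ ⨆ (j : Fin n) (_ : (j : ℕ) < (i : ℕ)),
      Submodule.torsionBySet A M (p j ^ m j : Ideal A) := by
  set S : Finset (Fin n) := {j | (j : ℕ) < (i : ℕ)} with hS
  have hcop : ∀ j k, j ≠ k → p j ^ m j ⊔ p k ^ m k = ⊤ := fun j k hjk =>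
    Ideal.pow_sup_pow_eq_top (hcomax j k hjk)
  have hprod : ∏ j ∈ S, p j ^ m j = ⨅ j ∈ S, p j ^ m j :=
    Ideal.prod_eq_iInf_of_pairwise_isCoprime fun j _ k _ hjk =>
      Ideal.isCoprime_iff_sup_eq.mpr (hcop j k hjk)
  have hsup := Submodule.iSup_torsionBySet_ideal_eq_torsionBySet_iInf (M := M) (S := S)
    (p := fun j => p j ^ m j) fun j _ k _ hjk => hcop j k hjk
  simp only [hS, Finset.mem_filter, Finset.mem_univ, true_and] at hsup
  rw [hsup]
  intro x hx
  refine (Submodule.mem_torsionBySet_iff _ _).mpr fun ⟨a, ha⟩ => ?_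
  have hax : a • x ∈ (∏ j ∈ S, p j ^ m j) • G i :=
    Submodule.smul_mem_smul (by rw [hprod]; simpa [hS] using ha) hx
  rwa [hG.prod_smul_eq_bot hm i, Submodule.mem_bot] at hax

end IsCoprimaryFiltration

/-- Let `A` be a commutative Noetherian ring and `M` a nonzero finitely
generated `A`-module with `Ass(M) = {p 0, …, p (n-1)}`, the `p i` pairwise distinct and
pairwise comaximal, and set `Mⱼ = ⋂_{k ≠ j} ker (M → M_{p k})`.  If `0 = G₀ ⊆ ⋯ ⊆ Gₙ = M`
is a coprimary filtration of `M` with respect to the enumeration `p`, then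
`Gᵢ = ∑_{j < i} Mⱼ` for every `i ≥ 1`. -/
theorem coprimary_filtration_eq_sup
    {A : Type*} [CommRing A] [IsNoetherianRing A]
    {M : Type*} [AddCommGroup M] [Module A M] [Module.Finite A M] [Nontrivial M]
    {n : ℕ} (p : Fin n → Ideal A) (hprime : ∀ i, (p i).IsPrime)
    (hinj : Function.Injective p)
    (hAss : associatedPrimes A M = Set.range p)
    (horder : ∀ a b, p a < p b → b < a)
    (hcomax : ∀ i j, i ≠ j → p i ⊔ p j = ⊤)
    (N : Fin n → Submodule A M)
    (hN : ∀ j, N j = ⨅ (k : Fin n) (_ : k ≠ j),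
      LinearMap.ker (LocalizedModule.mkLinearMap
        (@Ideal.primeCompl A _ (p k) (hprime k)) M))
    (G : Fin (n + 1) → Submodule A M) (hG : IsCoprimaryFiltration p G) :
    ∀ i : Fin (n + 1), 1 ≤ (i : ℕ) →
      G i = ⨆ (j : Fin n) (_ : (j : ℕ) < (i : ℕ)), N j := by
  intro i _
  apply le_antisymm
  · choose m hm using hG.exists_pow_smul_le
    refine (hG.le_iSup_torsionBySet hm hcomax i).trans (iSup₂_mono fun j _ => ?_)
    rw [hN j]
    refine le_iInf₂ fun k hk => ?_
    have := hprime k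
    exact torsionBySet_pow_le_ker_mkLinearMap (hcomax j k hk.symm) (m j)
  · refine iSup₂_le fun j hj x hx => hG.mem_of_forall_exists_smul_eq_zero i fun k hk => ?_
    rw [hN j] at hx
    simp only [Submodule.mem_iInf] at hx
    have := hprime k
    obtain ⟨s, hs, hsx⟩ := LocalizedModule.mem_ker_mkLinearMap_iff.mp
      (hx k fun h => by subst h; omega)
    exact ⟨s, hs, hsx⟩
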